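/- Khintchine's transference principle: Let n be a positive integer and let θ = (ξ₁, …, ξₙ) be a tuple of real numbers such that 1, ξ₁, …, ξₙ are linearly independent over ℚ. Set ω = ω(θ) and ᵗω = ω(ᵗθ). Then ω ≥ n·ᵗω + (n − 1) and ᵗω ≥ ω / ((n−1)·ω + n), with the natural conventions when ω or ᵗω is infinite. -/

import Mathlib

open scoped ENNReal

/-- The exponent `ω(θ)` of asymptotic approximation to `θ = (ξ₁,…,ξₙ)` by linear
forms: the supremum in `[0,∞]` of the `w` such that, for infinitely many positive
integers `N`, the system `|x₀ + x₁ξ₁ + ⋯ + xₙξₙ| ≤ N^(-w)`,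
`0 < max |xᵢ| ≤ N` has an integer solution. -/
noncomputable def omegaLin (n : ℕ) (θ : Fin n → ℝ) : ℝ≥0∞ :=
  ⨆ w ∈ {w : ℝ |
    {N : ℕ | 0 < N ∧ ∃ x : Fin (n + 1) → ℤ, x ≠ 0 ∧ (∀ i, |x i| ≤ (N : ℤ)) ∧
      |(x 0 : ℝ) + ∑ i : Fin n, (x i.succ : ℝ) * θ i| ≤ (N : ℝ) ^ (-w)}.Infinite},
    ENNReal.ofReal w

/-- The exponent `ω(ᵗθ)` of asymptotic simultaneous approximation of
`θ = (ξ₁,…,ξₙ)` by rational numbers: the supremum in `[0,∞]` of the `w` such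
that, for infinitely many positive integers `N`, the system
`max_{1≤i≤n} |xᵢ - x₀ξᵢ| ≤ N^(-w)`, `0 < max |xᵢ| ≤ N` has an integer solution. -/
noncomputable def omegaSim (n : ℕ) (θ : Fin n → ℝ) : ℝ≥0∞ :=
  ⨆ w ∈ {w : ℝ |
    {N : ℕ | 0 < N ∧ ∃ x : Fin (n + 1) → ℤ, x ≠ 0 ∧ (∀ i, |x i| ≤ (N : ℤ)) ∧
      ∀ i : Fin n, |(x i.succ : ℝ) - (x 0 : ℝ) * θ i| ≤ (N : ℝ) ^ (-w)}.Infinite},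
    ENNReal.ofReal w

/-- The positive integers `N` for which some nonzero integer vector of height at most `N`
satisfies `F x ≤ N ^ (-w)`. -/
def approxSet {n : ℕ} (F : (Fin (n + 1) → ℤ) → ℝ) (w : ℝ) : Set ℕ :=
  {N : ℕ | 0 < N ∧ ∃ x : Fin (n + 1) → ℤ, x ≠ 0 ∧ (∀ i, |x i| ≤ (N : ℤ)) ∧
    F x ≤ (N : ℝ) ^ (-w)}

/-- The exponent of approximation attached to an error function `F`. -/
noncomputable def approxExponent {n : ℕ} (F : (Fin (n + 1) → ℤ) → ℝ) : ℝ≥0∞ :=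
  ⨆ w ∈ {w : ℝ | (approxSet F w).Infinite}, ENNReal.ofReal w

/-- The absolute value of the linear form with coefficients `x` at `(1, θ)`. -/
noncomputable def linError {n : ℕ} (θ : Fin n → ℝ) (x : Fin (n + 1) → ℤ) : ℝ :=
  |(x 0 : ℝ) + ∑ i : Fin n, (x i.succ : ℝ) * θ i|

/-- The error of `x` as a simultaneous approximation to `θ`. -/
noncomputable def simError {n : ℕ} (θ : Fin n → ℝ) (x : Fin (n + 1) → ℤ) : ℝ :=
  ‖fun i : Fin n => (x i.succ : ℝ) - (x 0 : ℝ) * θ i‖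

theorem omegaLin_eq_approxExponent (n : ℕ) (θ : Fin n → ℝ) :
    omegaLin n θ = approxExponent (linError θ) := rfl

theorem omegaSim_eq_approxExponent (n : ℕ) (θ : Fin n → ℝ) :
    omegaSim n θ = approxExponent (simError θ) := by
  have h (N : ℕ) (w : ℝ) (x : Fin (n + 1) → ℤ) :
      (∀ i : Fin n, |(x i.succ : ℝ) - (x 0 : ℝ) * θ i| ≤ (N : ℝ) ^ (-w)) ↔
        simError θ x ≤ (N : ℝ) ^ (-w) := by
    rw [simError, pi_norm_le_iff_of_nonneg (by positivity)]
    simp only [Real.norm_eq_abs]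
  simp only [omegaSim, approxExponent, approxSet, h]

theorem abs_sub_le_simError {n : ℕ} (θ : Fin n → ℝ) (x : Fin (n + 1) → ℤ) (i : Fin n) :
    |(x i.succ : ℝ) - (x 0 : ℝ) * θ i| ≤ simError θ x :=
  norm_le_pi_norm (fun i : Fin n => (x i.succ : ℝ) - (x 0 : ℝ) * θ i) i

theorem abs_le_sum_abs {n : ℕ} (θ : Fin n → ℝ) (i : Fin n) : |θ i| ≤ ∑ k, |θ k| :=
  Finset.single_le_sum (f := fun k => |θ k|) (fun _ _ => abs_nonneg _) (Finset.mem_univ i)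

theorem eq_zero_of_linError_eq_zero {n : ℕ} {θ : Fin n → ℝ}
    (hindep : LinearIndependent ℚ (Fin.cons (1 : ℝ) θ : Fin (n + 1) → ℝ))
    {x : Fin (n + 1) → ℤ} (hx : linError θ x = 0) : x = 0 := by
  rw [Fintype.linearIndependent_iff] at hindep
  have h := hindep (fun i => (x i : ℚ)) (by
    rw [Fin.sum_univ_succ]
    simpa [linError, Rat.smul_def] using hx)
  ext i
  simpa using h i

theorem eq_zero_of_simError_eq_zero {n : ℕ} (hn : 0 < n) {θ : Fin n → ℝ}
    (hindep : LinearIndependent ℚ (Fin.cons (1 : ℝ) θ : Fin (n + 1) → ℝ))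
    {x : Fin (n + 1) → ℤ} (hx : simError θ x = 0) : x = 0 := by
  have h (i : Fin n) : (x i.succ : ℝ) - (x 0 : ℝ) * θ i = 0 :=
    abs_nonpos_iff.mp ((abs_sub_le_simError θ x i).trans hx.le)
  let j : Fin n := ⟨0, hn⟩
  have hy : (Fin.cons (x j.succ) (Pi.single j (-x 0)) : Fin (n + 1) → ℤ) = 0 := by
    apply eq_zero_of_linError_eq_zero hindep
    rw [linError, abs_eq_zero, Finset.sum_eq_single j]
    · simp only [Fin.cons_zero, Fin.cons_succ, Pi.single_eq_same]
      push_cast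
      linarith [h j]
    · intro i _ hi
      simp [hi]
    · simp
  have h0 : x 0 = 0 := by
    have := congrFun hy j.succ
    simpa using this
  ext i
  refine Fin.cases h0 (fun i => ?_) i
  have := h i
  simpa [h0] using this

/-- Approximations of positive exponent leave every finite set. -/
theorem exists_notMem_of_infinite_approxSet {n : ℕ} {F : (Fin (n + 1) → ℤ) → ℝ}
    (hF : ∀ x, 0 ≤ F x) (hF0 : ∀ x, F x = 0 → x = 0) {w : ℝ} (hw : 0 < w)
    (hinf : (approxSet F w).Infinite) (S : Set (Fin (n + 1) → ℤ)) (hS : S.Finite) :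
    ∃ N : ℕ, 0 < N ∧ ∃ x : Fin (n + 1) → ℤ, x ≠ 0 ∧ x ∉ S ∧ (∀ i, |x i| ≤ (N : ℤ)) ∧
      F x ≤ (N : ℝ) ^ (-w) ∧ F x < 1 := by
  have ht : Filter.Tendsto (fun N : ℕ => (N : ℝ) ^ (-w)) Filter.atTop (nhds 0) :=
    (tendsto_rpow_neg_atTop hw).comp tendsto_natCast_atTop_atTop
  have h1 : ∀ᶠ N : ℕ in Filter.atTop, (N : ℝ) ^ (-w) < 1 := ht.eventually_lt_const one_pos
  have h2 : ∀ᶠ N : ℕ in Filter.atTop, ∀ x ∈ S, x ≠ 0 → (N : ℝ) ^ (-w) < F x := by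
    rw [Filter.eventually_all_finite hS]
    intro x _
    by_cases hx : x = 0
    · simp [hx]
    · filter_upwards [ht.eventually_lt_const (lt_of_le_of_ne (hF x) fun h => hx (hF0 x h.symm))]
        with N hN _ using hN
  obtain ⟨N, ⟨hN, x, hx, hxN, hxF⟩, hN1, hN2⟩ :=
    ((Nat.frequently_atTop_iff_infinite.mpr hinf).and_eventually (h1.and h2)).exists
  exact ⟨N, hN, x, hx, fun hxS => (hN2 x hxS hx).not_ge hxF, hxN, hxF, hxF.trans_lt hN1⟩

/-- A family of approximations of height `≪ Y ^ a` and error `≪ Y ^ (-b)`, with `Y` unbounded,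
yields the exponent `b / a`. -/
theorem ofReal_div_le_approxExponent {n : ℕ} {F : (Fin (n + 1) → ℤ) → ℝ} {C a b : ℝ}
    (hC : 0 < C) (ha : 0 < a)
    (h : ∀ B : ℕ, ∃ Y : ℕ, B < Y ∧ ∃ x : Fin (n + 1) → ℤ, x ≠ 0 ∧
      (∀ i, |(x i : ℝ)| ≤ C * (Y : ℝ) ^ a) ∧ F x ≤ C * (Y : ℝ) ^ (-b)) :
    ENNReal.ofReal (b / a) ≤ approxExponent F := by
  have key (v : ℝ) (hv : 0 ≤ v) (hvb : v < b / a) : (approxSet F v).Infinite := by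
    rw [lt_div_iff₀ ha] at hvb
    refine Nat.frequently_atTop_iff_infinite.mp (Filter.frequently_atTop.mpr fun B => ?_)
    have t1 : Filter.Tendsto (fun Y : ℕ => C * (Y : ℝ) ^ a) Filter.atTop Filter.atTop :=
      ((tendsto_rpow_atTop ha).comp tendsto_natCast_atTop_atTop).const_mul_atTop hC
    have t2 : Filter.Tendsto (fun Y : ℕ => (Y : ℝ) ^ (b - v * a)) Filter.atTop Filter.atTop :=
      (tendsto_rpow_atTop (by linarith)).comp tendsto_natCast_atTop_atTop
    obtain ⟨Y₀, hY₀⟩ := Filter.eventually_atTop.mp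
      ((t1.eventually_ge_atTop (max 1 (B : ℝ))).and
        (t2.eventually_ge_atTop (C * (2 * C) ^ v)))
    obtain ⟨Y, hY, x, hx, hxY, hxF⟩ := h Y₀
    obtain ⟨hY1, hY2⟩ := hY₀ Y hY.le
    have hYpos : (0 : ℝ) < Y := by exact_mod_cast (Nat.zero_le _).trans_lt hY
    have hle : C * (Y : ℝ) ^ a ≤ (⌈C * (Y : ℝ) ^ a⌉₊ : ℝ) := Nat.le_ceil _
    have hge : (⌈C * (Y : ℝ) ^ a⌉₊ : ℝ) ≤ 2 * C * (Y : ℝ) ^ a := by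
      have h1 := Nat.ceil_lt_add_one (a := C * (Y : ℝ) ^ a) (by positivity)
      have h2 := (le_max_left _ _).trans hY1
      linarith
    have hNpos : (0 : ℝ) < (⌈C * (Y : ℝ) ^ a⌉₊ : ℝ) := lt_of_lt_of_le (by positivity) hle
    refine ⟨⌈C * (Y : ℝ) ^ a⌉₊, ?_, by exact_mod_cast hNpos, x, hx, fun i => ?_, ?_⟩
    · exact_mod_cast ((le_max_right _ _).trans hY1).trans hle
    · have := (hxY i).trans hle
      exact_mod_cast this
    · refine hxF.trans ?_
      have hvN : (2 * C * (Y : ℝ) ^ a) ^ (-v) ≤ (⌈C * (Y : ℝ) ^ a⌉₊ : ℝ) ^ (-v) :=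
        Real.rpow_le_rpow_of_nonpos hNpos hge (by linarith)
      refine le_trans ?_ hvN
      rw [Real.mul_rpow (by positivity) (by positivity), ← Real.rpow_mul hYpos.le,
        Real.rpow_neg (by positivity : (0 : ℝ) ≤ 2 * C), inv_mul_eq_div,
        le_div_iff₀ (by positivity)]
      calc C * (Y : ℝ) ^ (-b) * (2 * C) ^ v = C * (2 * C) ^ v * (Y : ℝ) ^ (-b) := by ring
        _ ≤ (Y : ℝ) ^ (b - v * a) * (Y : ℝ) ^ (-b) := by gcongr
        _ = (Y : ℝ) ^ (a * -v) := by rw [← Real.rpow_add hYpos]; ring_nf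
  rcases le_or_gt (b / a) 0 with hba | hba
  · simp [ENNReal.ofReal_of_nonpos hba]
  refine le_of_forall_lt fun c hc => ?_
  have hctop : c ≠ ⊤ := (hc.trans ENNReal.ofReal_lt_top).ne
  obtain ⟨d, hd1, hd2⟩ := exists_between hc
  have hdtop : d ≠ ⊤ := (hd2.trans ENNReal.ofReal_lt_top).ne
  have hinf := key d.toReal ENNReal.toReal_nonneg
    ((ENNReal.lt_ofReal_iff_toReal_lt hdtop).mp hd2)
  refine hd1.trans_le ?_
  rw [← ENNReal.ofReal_toReal hdtop]
  exact le_iSup₂ (f := fun (w : ℝ) (_ : w ∈ {w : ℝ | (approxSet F w).Infinite}) =>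
    ENNReal.ofReal w) d.toReal hinf

/-- A small nontrivial integer vector orthogonal to a given one. -/
theorem exists_small_orthogonal {n : ℕ} (x : Fin (n + 1) → ℤ) (hx : x 0 ≠ 0) (H : ℕ)
    (hH : (x 0).natAbs < (H + 1) ^ n) :
    ∃ y : Fin (n + 1) → ℤ, y ≠ 0 ∧ (∀ i : Fin n, |y i.succ| ≤ H) ∧
      y 0 * x 0 + ∑ i : Fin n, y i.succ * x i.succ = 0 := by
  have : NeZero (x 0).natAbs := ⟨Int.natAbs_ne_zero.mpr hx⟩
  obtain ⟨u, v, huv, he⟩ := Fintype.exists_ne_map_eq_of_card_lt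
    (fun u : Fin n → Fin (H + 1) =>
      ((∑ i, ((u i : ℕ) : ℤ) * x i.succ : ℤ) : ZMod (x 0).natAbs))
    (by simpa [ZMod.card] using hH)
  rw [ZMod.intCast_eq_intCast_iff_dvd_sub, Int.natAbs_dvd] at he
  obtain ⟨c, hc⟩ := he
  refine ⟨Fin.cons (-c) (fun i => ((v i : ℕ) : ℤ) - ((u i : ℕ) : ℤ)), fun h => huv ?_,
    fun i => ?_, ?_⟩
  · ext i
    have := congrFun h i.succ
    simp only [Fin.cons_succ, Pi.zero_apply] at this
    omega
  · have := (u i).isLt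
    have := (v i).isLt
    simp only [Fin.cons_succ]
    rw [abs_le]
    omega
  · simp only [Fin.cons_zero, Fin.cons_succ, sub_mul, Finset.sum_sub_distrib]
    linarith

/-- An integer vector orthogonal to a given one, all but one of whose coordinates approximate
the corresponding multiples of `θ` well. -/
theorem exists_approx_orthogonal {n : ℕ} (θ : Fin n → ℝ) (y : Fin (n + 1) → ℤ) (j : Fin n)
    (hy : y j.succ ≠ 0) (M : ℕ) (hM : 0 < M) :
    ∃ x : Fin (n + 1) → ℤ, x 0 ≠ 0 ∧ |x 0| ≤ (y j.succ).natAbs * (M : ℤ) ^ (n - 1) ∧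
      y 0 * x 0 + ∑ i : Fin n, y i.succ * x i.succ = 0 ∧
      ∀ i, i ≠ j → |(x i.succ : ℝ) - (x 0 : ℝ) * θ i| ≤ 1 / M := by
  have : NeZero (y j.succ).natAbs := ⟨Int.natAbs_ne_zero.mpr hy⟩
  have hMR : (0 : ℝ) < M := by exact_mod_cast hM
  have hbox (t : ℝ) : ⌊M * Int.fract t⌋₊ < M := by
    rw [Nat.floor_lt (by positivity)]
    nlinarith [Int.fract_lt_one t]
  obtain ⟨k, l, hkl, he⟩ := Fintype.exists_ne_map_eq_of_card_lt
    (fun k : Fin ((y j.succ).natAbs * M ^ (n - 1) + 1) =>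
      (((y 0 * ((k : ℕ) : ℤ) + ∑ i : Fin n, y i.succ * ⌊((k : ℕ) : ℝ) * θ i⌋ : ℤ) :
          ZMod (y j.succ).natAbs),
        fun i : {i : Fin n // i ≠ j} =>
          (⟨⌊M * Int.fract (((k : ℕ) : ℝ) * θ i)⌋₊, hbox _⟩ : Fin M)))
    (by simp [ZMod.card])
  rw [Prod.mk.injEq, ZMod.intCast_eq_intCast_iff_dvd_sub, Int.natAbs_dvd] at he
  obtain ⟨⟨c, hc⟩, hb⟩ := he
  refine ⟨Fin.cons (((l : ℕ) : ℤ) - ((k : ℕ) : ℤ)) (fun i =>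
    ⌊((l : ℕ) : ℝ) * θ i⌋ - ⌊((k : ℕ) : ℝ) * θ i⌋ - if i = j then c else 0), ?_, ?_, ?_, ?_⟩
  · simp only [Fin.cons_zero]
    intro h
    exact hkl (Fin.ext (by omega))
  · have h1 := k.isLt
    have h2 := l.isLt
    have h3 : (((y j.succ).natAbs * M ^ (n - 1) : ℕ) : ℤ) =
      (y j.succ).natAbs * (M : ℤ) ^ (n - 1) := by push_cast; rfl
    rw [← h3, Fin.cons_zero, abs_le]
    omega
  · simp only [Fin.cons_zero, Fin.cons_succ, mul_sub, Finset.sum_sub_distrib, mul_ite, mul_zero,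
      Finset.sum_ite_eq', Finset.mem_univ, if_true]
    linarith
  · intro i hi
    have h1 := congrArg Fin.val (congrFun hb ⟨i, hi⟩)
    simp only at h1
    have f1 := Nat.floor_le (a := M * Int.fract (((k : ℕ) : ℝ) * θ i)) (by positivity)
    have f2 := Nat.lt_floor_add_one (M * Int.fract (((k : ℕ) : ℝ) * θ i))
    have f3 := Nat.floor_le (a := M * Int.fract (((l : ℕ) : ℝ) * θ i)) (by positivity)
    have f4 := Nat.lt_floor_add_one (M * Int.fract (((l : ℕ) : ℝ) * θ i))
    rw [h1] at f1 f2
    have g1 := Int.floor_add_fract (((k : ℕ) : ℝ) * θ i)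
    have g2 := Int.floor_add_fract (((l : ℕ) : ℝ) * θ i)
    simp only [Fin.cons_zero, Fin.cons_succ, hi, if_false]
    push_cast
    have e : (⌊((l : ℕ) : ℝ) * θ i⌋ : ℝ) - ⌊((k : ℕ) : ℝ) * θ i⌋ - 0 -
        (((l : ℕ) : ℝ) - ((k : ℕ) : ℝ)) * θ i =
        Int.fract (((k : ℕ) : ℝ) * θ i) - Int.fract (((l : ℕ) : ℝ) * θ i) := by linarith
    rw [e, abs_sub_le_iff, le_div_iff₀ hMR, le_div_iff₀ hMR]
    constructor <;> linarith

/-- The bilinear identity behind the transference. -/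
theorem mul_linForm_add_sum {n : ℕ} (θ : Fin n → ℝ) {x y : Fin (n + 1) → ℤ}
    (h : y 0 * x 0 + ∑ i : Fin n, y i.succ * x i.succ = 0) :
    (x 0 : ℝ) * ((y 0 : ℝ) + ∑ i : Fin n, (y i.succ : ℝ) * θ i) +
      ∑ i : Fin n, (y i.succ : ℝ) * ((x i.succ : ℝ) - (x 0 : ℝ) * θ i) = 0 := by
  have h' : (y 0 : ℝ) * x 0 + ∑ i : Fin n, (y i.succ : ℝ) * x i.succ = 0 := by exact_mod_cast h
  simp only [mul_sub, Finset.sum_sub_distrib, mul_add, Finset.mul_sum]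
  have : ∑ i : Fin n, (x 0 : ℝ) * ((y i.succ : ℝ) * θ i) =
      ∑ i : Fin n, (y i.succ : ℝ) * ((x 0 : ℝ) * θ i) :=
    Finset.sum_congr rfl fun i _ => by ring
  linarith

/-- From simultaneous approximations of exponent `w` to linear forms of exponent
`n * w + n - 1`. -/
theorem ofReal_le_approxExponent_linError {n : ℕ} (hn : 0 < n) (θ : Fin n → ℝ) {w : ℝ}
    (hw : 0 ≤ w)
    (h : ∀ B : ℕ, ∃ x : Fin (n + 1) → ℤ, B < (x 0).natAbs ∧
      simError θ x ≤ ((x 0).natAbs : ℝ) ^ (-w)) :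
    ENNReal.ofReal (n * w + (n - 1)) ≤ approxExponent (linError θ) := by
  have hnR : (0 : ℝ) < n := by exact_mod_cast hn
  have hΘ : 0 ≤ ∑ i, |θ i| := Finset.sum_nonneg fun _ _ => abs_nonneg _
  have hab : (n : ℝ) * w + (n - 1) = (1 + w - 1 / n) / (1 / n) := by field_simp; ring
  rw [hab]
  refine ofReal_div_le_approxExponent (C := 1 + n + ∑ i, |θ i|) (by positivity)
    (by positivity) fun B => ?_
  obtain ⟨x, hxB, hxE⟩ := h B
  refine ⟨(x 0).natAbs, hxB, ?_⟩
  have hX0 : 0 < (x 0).natAbs := (Nat.zero_le _).trans_lt hxB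
  have hXabs : |(x 0 : ℝ)| = ((x 0).natAbs : ℝ) := by
    rw [Nat.cast_natAbs, Int.cast_abs]
  set X := (x 0).natAbs
  have hX1 : (1 : ℝ) ≤ X := by exact_mod_cast hX0
  have hXpos : (0 : ℝ) < X := by linarith
  set t : ℝ := (X : ℝ) ^ (1 / n : ℝ) with ht
  have ht1 : 1 ≤ t := Real.one_le_rpow hX1 (by positivity)
  have htn : t ^ n = X := by
    rw [ht, ← Real.rpow_natCast, ← Real.rpow_mul hXpos.le]
    simp [hnR.ne']
  have hHt : (⌊t⌋₊ : ℝ) ≤ t := Nat.floor_le (by linarith)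
  obtain ⟨y, hy, hyH, hyx⟩ := exists_small_orthogonal x (by omega) ⌊t⌋₊ (by
    have : t ^ n < ((⌊t⌋₊ : ℝ) + 1) ^ n :=
      pow_lt_pow_left₀ (Nat.lt_floor_add_one t) (by linarith) hn.ne'
    rw [htn] at this
    exact_mod_cast this)
  have hyt (i : Fin n) : |(y i.succ : ℝ)| ≤ t := by
    refine le_trans ?_ hHt
    exact_mod_cast hyH i
  have hid := mul_linForm_add_sum θ hyx
  have hsum : |∑ i : Fin n, (y i.succ : ℝ) * ((x i.succ : ℝ) - (x 0 : ℝ) * θ i)| ≤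
      n * (t * (X : ℝ) ^ (-w)) := by
    refine (Finset.abs_sum_le_sum_abs _ _).trans ?_
    refine (Finset.sum_le_card_nsmul _ _ (t * (X : ℝ) ^ (-w)) fun i _ => ?_).trans ?_
    · rw [abs_mul]
      exact mul_le_mul (hyt i) ((abs_sub_le_simError θ x i).trans hxE) (abs_nonneg _)
        (by linarith)
    · simp
  have hL : X * linError θ y ≤ n * (t * (X : ℝ) ^ (-w)) := by
    rw [linError, ← hXabs, ← abs_mul, eq_neg_of_add_eq_zero_left hid, abs_neg, hXabs]
    exact hsum
  have hL' : linError θ y ≤ n * (X : ℝ) ^ (-(1 + w - 1 / n : ℝ)) := by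
    have e : (X : ℝ) ^ (-(1 + w - 1 / n : ℝ)) = t * (X : ℝ) ^ (-w) / X := by
      rw [ht, ← Real.rpow_add hXpos, ← Real.rpow_sub_one hXpos.ne']
      ring_nf
    rw [e, ← mul_div_assoc, le_div_iff₀ hXpos]
    linarith
  have hLt : linError θ y ≤ n * t := by
    refine hL'.trans (mul_le_mul_of_nonneg_left ?_ hnR.le)
    exact Real.rpow_le_rpow_of_exponent_le hX1 (by
      have : (1 / n : ℝ) ≤ 1 := by
        rw [div_le_one hnR]
        exact_mod_cast hn
      linarith)
  refine ⟨y, hy, fun i => ?_, hL'.trans ?_⟩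
  · refine Fin.cases ?_ (fun i => ?_) i
    · have h1 : |∑ i : Fin n, (y i.succ : ℝ) * θ i| ≤ t * ∑ i, |θ i| := by
        rw [Finset.mul_sum]
        refine (Finset.abs_sum_le_sum_abs _ _).trans (Finset.sum_le_sum fun i _ => ?_)
        rw [abs_mul]
        exact mul_le_mul_of_nonneg_right (hyt i) (abs_nonneg _)
      have h2 := abs_sub ((y 0 : ℝ) + ∑ i : Fin n, (y i.succ : ℝ) * θ i)
        (∑ i : Fin n, (y i.succ : ℝ) * θ i)
      rw [add_sub_cancel_right] at h2
      rw [linError] at hLt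
      linarith
    · have := hyt i
      nlinarith
  · gcongr
    linarith

/-- From linear forms of exponent `w` to simultaneous approximations of exponent
`w / ((n - 1) * w + n)`. -/
theorem ofReal_le_approxExponent_simError {n : ℕ} (hn : 0 < n) (θ : Fin n → ℝ) {w : ℝ}
    (hw : 0 < w)
    (h : ∀ B : ℕ, ∃ (y : Fin (n + 1) → ℤ) (j : Fin n), B < (y j.succ).natAbs ∧
      (∀ i : Fin n, (y i.succ).natAbs ≤ (y j.succ).natAbs) ∧
      linError θ y ≤ ((y j.succ).natAbs : ℝ) ^ (-w)) :
    ENNReal.ofReal (w / ((n - 1) * w + n)) ≤ approxExponent (simError θ) := by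
  have hnR : (1 : ℝ) ≤ n := by exact_mod_cast hn
  have hn1 : (0 : ℝ) ≤ n - 1 := by linarith
  have hΘ : 0 ≤ ∑ i, |θ i| := Finset.sum_nonneg fun _ _ => abs_nonneg _
  have hab : w / ((n - 1) * w + n) = (w / n) / (1 + w / n * (n - 1)) := by
    field_simp
    ring_nf
  rw [hab]
  refine ofReal_div_le_approxExponent (C := (2 ^ n + n) * (1 + ∑ i, |θ i|)) (by positivity)
    (by positivity) fun B => ?_
  obtain ⟨y, j, hyB, hyj, hyL⟩ := h B
  refine ⟨(y j.succ).natAbs, hyB, ?_⟩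
  have hY0 : 0 < (y j.succ).natAbs := (Nat.zero_le _).trans_lt hyB
  have hYabs (i : Fin n) : |(y i.succ : ℝ)| = ((y i.succ).natAbs : ℝ) := by
    rw [Nat.cast_natAbs, Int.cast_abs]
  have hyj0 : y j.succ ≠ 0 := by omega
  have hyY (i : Fin n) : |(y i.succ : ℝ)| ≤ ((y j.succ).natAbs : ℝ) := by
    rw [hYabs]
    exact_mod_cast hyj i
  have hYj := hYabs j
  set Y := (y j.succ).natAbs with hYdef
  have hY1 : (1 : ℝ) ≤ Y := by exact_mod_cast hY0
  have hYpos : (0 : ℝ) < Y := by linarith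
  set t : ℝ := (Y : ℝ) ^ (w / n : ℝ) with ht
  have ht1 : 1 ≤ t := Real.one_le_rpow hY1 (by positivity)
  have htpos : 0 < t := by linarith
  have htn : t ^ n = (Y : ℝ) ^ w := by
    rw [ht, ← Real.rpow_natCast, ← Real.rpow_mul hYpos.le, div_mul_cancel₀ _ (by positivity)]
  have htn1 : Y * t ^ (n - 1) = (Y : ℝ) ^ (1 + w / n * (n - 1)) := by
    rw [ht, ← Real.rpow_natCast, ← Real.rpow_mul hYpos.le, Real.rpow_add hYpos, Real.rpow_one,
      Nat.cast_sub hn, Nat.cast_one]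
  have hM : 0 < ⌈t⌉₊ := Nat.ceil_pos.mpr htpos
  have hMt : t ≤ ⌈t⌉₊ := Nat.le_ceil t
  have hM2 : (⌈t⌉₊ : ℝ) ≤ 2 * t := by
    have := Nat.ceil_lt_add_one htpos.le
    linarith
  obtain ⟨x, hx0, hxle, hyx, hxi⟩ := exists_approx_orthogonal θ y j hyj0 ⌈t⌉₊ hM
  have hMpow : (⌈t⌉₊ : ℝ) ^ (n - 1) ≤ 2 ^ n * t ^ (n - 1) := by
    calc (⌈t⌉₊ : ℝ) ^ (n - 1) ≤ (2 * t) ^ (n - 1) := by gcongr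
      _ = 2 ^ (n - 1) * t ^ (n - 1) := mul_pow _ _ _
      _ ≤ 2 ^ n * t ^ (n - 1) := by
        gcongr
        · norm_num
        · omega
  have hxle' : |(x 0 : ℝ)| ≤ Y * (2 ^ n * t ^ (n - 1)) := by
    refine le_trans ?_ (mul_le_mul_of_nonneg_left hMpow hYpos.le)
    rw [← hYdef] at hxle
    exact_mod_cast hxle
  have hxi' (i : Fin n) (hi : i ≠ j) : |(x i.succ : ℝ) - (x 0 : ℝ) * θ i| ≤ 1 / t :=
    (hxi i hi).trans (one_div_le_one_div_of_le htpos hMt)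
  have hid := mul_linForm_add_sum θ hyx
  have hxL : |(x 0 : ℝ)| * linError θ y ≤ Y * (2 ^ n / t) := by
    calc |(x 0 : ℝ)| * linError θ y ≤ Y * (2 ^ n * t ^ (n - 1)) * (Y : ℝ) ^ (-w) :=
          mul_le_mul hxle' hyL (abs_nonneg _) (by positivity)
      _ = Y * (2 ^ n / t) := by
        rw [Real.rpow_neg hYpos.le, ← htn]
        obtain ⟨m, rfl⟩ : ∃ m, n = m + 1 := ⟨n - 1, by omega⟩
        rw [Nat.add_sub_cancel]
        field_simp
        ring
  have hsum : |∑ i ∈ Finset.univ.erase j,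
      (y i.succ : ℝ) * ((x i.succ : ℝ) - (x 0 : ℝ) * θ i)| ≤ Y * (n / t) := by
    calc _ ≤ ∑ i ∈ Finset.univ.erase j,
          |(y i.succ : ℝ) * ((x i.succ : ℝ) - (x 0 : ℝ) * θ i)| :=
          Finset.abs_sum_le_sum_abs _ _
      _ ≤ ∑ _i ∈ Finset.univ.erase j, (Y : ℝ) * (1 / t) := by
          refine Finset.sum_le_sum fun i hi => ?_
          rw [abs_mul]
          exact mul_le_mul (hyY i) (hxi' i (Finset.ne_of_mem_erase hi)) (abs_nonneg _) hYpos.le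
      _ ≤ ∑ _i : Fin n, (Y : ℝ) * (1 / t) :=
          Finset.sum_le_sum_of_subset_of_nonneg (Finset.erase_subset _ _)
            fun _ _ _ => by positivity
      _ = Y * (n / t) := by
          simp only [Finset.sum_const, Finset.card_univ, Fintype.card_fin, nsmul_eq_mul]
          ring
  have hej : |(x j.succ : ℝ) - (x 0 : ℝ) * θ j| ≤ (2 ^ n + n) / t := by
    rw [← Finset.add_sum_erase Finset.univ
      (fun i : Fin n => (y i.succ : ℝ) * ((x i.succ : ℝ) - (x 0 : ℝ) * θ i))
      (Finset.mem_univ j)] at hid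
    have e : (y j.succ : ℝ) * ((x j.succ : ℝ) - (x 0 : ℝ) * θ j) =
        -((x 0 : ℝ) * ((y 0 : ℝ) + ∑ i : Fin n, (y i.succ : ℝ) * θ i) +
        ∑ i ∈ Finset.univ.erase j,
          (y i.succ : ℝ) * ((x i.succ : ℝ) - (x 0 : ℝ) * θ i)) := by linarith
    have e2 := congrArg abs e
    rw [abs_mul, hYj, abs_neg] at e2
    have h3 := abs_add_le ((x 0 : ℝ) * ((y 0 : ℝ) + ∑ i : Fin n, (y i.succ : ℝ) * θ i))
      (∑ i ∈ Finset.univ.erase j, (y i.succ : ℝ) * ((x i.succ : ℝ) - (x 0 : ℝ) * θ i))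
    rw [abs_mul] at h3
    rw [linError] at hxL
    refine le_of_mul_le_mul_left ?_ hYpos
    rw [add_div, mul_add, e2]
    linarith
  have he (i : Fin n) : |(x i.succ : ℝ) - (x 0 : ℝ) * θ i| ≤ (2 ^ n + n) / t := by
    by_cases hi : i = j
    · exact hi ▸ hej
    · refine (hxi' i hi).trans ?_
      gcongr
      have : (0 : ℝ) ≤ 2 ^ n := by positivity
      linarith
  have hA : (1 : ℝ) ≤ Y * t ^ (n - 1) := one_le_mul_of_one_le_of_one_le hY1 (one_le_pow₀ ht1)
  refine ⟨x, fun hx => hx0 (by simp [hx]), fun i => ?_, ?_⟩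
  · rw [← htn1]
    set A := Y * t ^ (n - 1)
    have h2n : (0 : ℝ) < 2 ^ n := by positivity
    have hxA : |(x 0 : ℝ)| ≤ (2 ^ n + n) * A := by
      refine hxle'.trans ?_
      have : (Y : ℝ) * (2 ^ n * t ^ (n - 1)) = 2 ^ n * A := by ring
      rw [this]
      gcongr
      linarith
    have hCA : 0 ≤ (2 ^ n + n) * A := by positivity
    refine Fin.cases ?_ (fun i => ?_) i
    · nlinarith
    · have h1 := he i
      have h2 : (2 ^ n + n : ℝ) / t ≤ (2 ^ n + n) * A :=
        (div_le_self (by positivity) ht1).trans (le_mul_of_one_le_right (by positivity) hA)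
      have h3 := abs_add_le ((x i.succ : ℝ) - (x 0 : ℝ) * θ i) ((x 0 : ℝ) * θ i)
      rw [sub_add_cancel, abs_mul] at h3
      have h4 : |(x 0 : ℝ)| * |θ i| ≤ (2 ^ n + n) * A * ∑ k, |θ k| :=
        mul_le_mul hxA (abs_le_sum_abs θ i) (abs_nonneg _) hCA
      linarith
  · rw [simError, pi_norm_le_iff_of_nonneg (by positivity)]
    intro i
    refine (he i).trans ?_
    rw [Real.rpow_neg hYpos.le, ← ht, ← div_eq_mul_inv]
    gcongr
    exact le_mul_of_one_le_right (by positivity) (by linarith)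

theorem rpow_neg_natCast_le_of_le {w : ℝ} (hw : 0 ≤ w) {m N : ℕ} (hm : 0 < m) (h : m ≤ N) :
    (N : ℝ) ^ (-w) ≤ (m : ℝ) ^ (-w) :=
  Real.rpow_le_rpow_of_nonpos (by exact_mod_cast hm) (by exact_mod_cast h) (by linarith)

theorem exists_simError_le_of_infinite {n : ℕ} (hn : 0 < n) {θ : Fin n → ℝ}
    (hindep : LinearIndependent ℚ (Fin.cons (1 : ℝ) θ : Fin (n + 1) → ℝ)) {w : ℝ} (hw : 0 < w)
    (hinf : (approxSet (simError θ) w).Infinite) (B : ℕ) :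
    ∃ x : Fin (n + 1) → ℤ, B < (x 0).natAbs ∧ simError θ x ≤ ((x 0).natAbs : ℝ) ^ (-w) := by
  have hΘ : 0 ≤ ∑ i, |θ i| := Finset.sum_nonneg fun _ _ => abs_nonneg _
  let c : ℤ := ⌈1 + B * (1 + ∑ i, |θ i|)⌉
  have hc : 1 + B * (1 + ∑ i, |θ i|) ≤ (c : ℝ) := Int.le_ceil _
  obtain ⟨N, -, x, -, hxS, hxN, hxF, hx1⟩ := exists_notMem_of_infinite_approxSet
    (F := simError θ) (fun _ => norm_nonneg _) (fun x hx => eq_zero_of_simError_eq_zero hn hindep hx) hw hinf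
    (Set.Icc (fun _ => -c) (fun _ => c)) (Set.finite_Icc _ _)
  have hB : B < (x 0).natAbs := by
    by_contra! hB
    have hx0 : |(x 0 : ℝ)| ≤ B := by
      rw [← Int.cast_abs, ← Nat.cast_natAbs]
      exact_mod_cast hB
    have hB0 : (0 : ℝ) ≤ B := by positivity
    have hall (i : Fin (n + 1)) : |(x i : ℝ)| ≤ c := by
      refine le_trans ?_ hc
      refine Fin.cases ?_ (fun i => ?_) i
      · nlinarith
      · have h1 := abs_sub_le_simError θ x i
        have h3 := abs_add_le ((x i.succ : ℝ) - (x 0 : ℝ) * θ i) ((x 0 : ℝ) * θ i)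
        rw [sub_add_cancel, abs_mul] at h3
        have h4 : |(x 0 : ℝ)| * |θ i| ≤ B * ∑ k, |θ k| :=
          mul_le_mul hx0 (abs_le_sum_abs θ i) (abs_nonneg _) hB0
        linarith
    have hall' (i : Fin (n + 1)) : |x i| ≤ c := by exact_mod_cast hall i
    exact hxS ⟨fun i => (abs_le.mp (hall' i)).1, fun i => (abs_le.mp (hall' i)).2⟩
  refine ⟨x, hB, hxF.trans (rpow_neg_natCast_le_of_le hw.le (by omega) ?_)⟩
  have := hxN 0
  rw [← Int.natCast_natAbs] at this
  omega

theorem exists_linError_le_of_infinite {n : ℕ} (hn : 0 < n) {θ : Fin n → ℝ}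
    (hindep : LinearIndependent ℚ (Fin.cons (1 : ℝ) θ : Fin (n + 1) → ℝ)) {w : ℝ} (hw : 0 < w)
    (hinf : (approxSet (linError θ) w).Infinite) (B : ℕ) :
    ∃ (y : Fin (n + 1) → ℤ) (j : Fin n), B < (y j.succ).natAbs ∧
      (∀ i : Fin n, (y i.succ).natAbs ≤ (y j.succ).natAbs) ∧
      linError θ y ≤ ((y j.succ).natAbs : ℝ) ^ (-w) := by
  have hΘ : 0 ≤ ∑ i, |θ i| := Finset.sum_nonneg fun _ _ => abs_nonneg _
  let c : ℤ := ⌈1 + B * (1 + ∑ i, |θ i|)⌉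
  have hc : 1 + B * (1 + ∑ i, |θ i|) ≤ (c : ℝ) := Int.le_ceil _
  obtain ⟨N, -, y, -, hyS, hyN, hyF, hy1⟩ := exists_notMem_of_infinite_approxSet
    (F := linError θ) (fun _ => abs_nonneg _) (fun x hx => eq_zero_of_linError_eq_zero hindep hx) hw hinf
    (Set.Icc (fun _ => -c) (fun _ => c)) (Set.finite_Icc _ _)
  have : Nonempty (Fin n) := ⟨⟨0, hn⟩⟩
  obtain ⟨j, hj⟩ := Finite.exists_max fun i : Fin n => (y i.succ).natAbs
  have hB : B < (y j.succ).natAbs := by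
    by_contra! hB
    have hy (i : Fin n) : |(y i.succ : ℝ)| ≤ B := by
      rw [← Int.cast_abs, ← Nat.cast_natAbs]
      exact_mod_cast (hj i).trans hB
    have hB0 : (0 : ℝ) ≤ B := by positivity
    have hall (i : Fin (n + 1)) : |(y i : ℝ)| ≤ c := by
      refine le_trans ?_ hc
      refine Fin.cases ?_ (fun i => ?_) i
      · have h1 : |∑ i : Fin n, (y i.succ : ℝ) * θ i| ≤ B * ∑ i, |θ i| := by
          rw [Finset.mul_sum]
          refine (Finset.abs_sum_le_sum_abs _ _).trans (Finset.sum_le_sum fun i _ => ?_)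
          rw [abs_mul]
          exact mul_le_mul_of_nonneg_right (hy i) (abs_nonneg _)
        have h2 := abs_sub ((y 0 : ℝ) + ∑ i : Fin n, (y i.succ : ℝ) * θ i)
          (∑ i : Fin n, (y i.succ : ℝ) * θ i)
        rw [add_sub_cancel_right] at h2
        rw [linError] at hy1
        linarith
      · have := hy i
        nlinarith
    have hall' (i : Fin (n + 1)) : |y i| ≤ c := by exact_mod_cast hall i
    exact hyS ⟨fun i => (abs_le.mp (hall' i)).1, fun i => (abs_le.mp (hall' i)).2⟩
  refine ⟨y, j, hB, hj, hyF.trans (rpow_neg_natCast_le_of_le hw.le (by omega) ?_)⟩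
  have := hyN j.succ
  rw [← Int.natCast_natAbs] at this
  omega

theorem natCast_sub_one_le_approxExponent_linError {n : ℕ} (hn : 0 < n) (θ : Fin n → ℝ) :
    ENNReal.ofReal (n - 1) ≤ approxExponent (linError θ) := by
  have h := ofReal_le_approxExponent_linError hn θ le_rfl fun B =>
    ⟨Fin.cons ((B : ℤ) + 1) (fun i => round (((B : ℝ) + 1) * θ i)), by
      rw [Fin.cons_zero]
      omega, by
      rw [simError, pi_norm_le_iff_of_nonneg (by positivity)]
      intro i
      simp only [Fin.cons_zero, Fin.cons_succ, neg_zero, Real.rpow_zero, Real.norm_eq_abs]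
      push_cast
      rw [abs_sub_comm]
      exact (abs_sub_round _).trans (by norm_num)⟩
  simpa using h

/-- Khintchine's transference principle. -/
theorem khintchine_transference (n : ℕ) (hn : 0 < n) (θ : Fin n → ℝ)
    (hindep : LinearIndependent ℚ (Fin.cons (1 : ℝ) θ : Fin (n + 1) → ℝ)) :
    omegaLin n θ ≥ (n : ℝ≥0∞) * omegaSim n θ + ((n : ℝ≥0∞) - 1) ∧
    omegaSim n θ ≥ omegaLin n θ / (((n : ℝ≥0∞) - 1) * omegaLin n θ + (n : ℝ≥0∞)) := by
  rw [omegaLin_eq_approxExponent, omegaSim_eq_approxExponent]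
  have hnR : (1 : ℝ) ≤ n := by exact_mod_cast hn
  have hn1 : (n : ℝ≥0∞) - 1 = ENNReal.ofReal (n - 1) := by
    rw [ENNReal.ofReal_sub _ zero_le_one, ENNReal.ofReal_natCast, ENNReal.ofReal_one]
  rw [hn1]
  have hbase := natCast_sub_one_le_approxExponent_linError hn θ
  constructor
  · rw [ge_iff_le, ← ENNReal.le_sub_iff_add_le_right ENNReal.ofReal_ne_top hbase, mul_comm,
      ← ENNReal.le_div_iff_mul_le (by simp [hn.ne']) (by simp)]
    refine iSup₂_le fun w hw => ?_
    rcases le_or_gt w 0 with hw0 | hw0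
    · simp [ENNReal.ofReal_of_nonpos hw0]
    rw [ENNReal.le_div_iff_mul_le (by simp [hn.ne']) (by simp),
      ENNReal.le_sub_iff_add_le_right ENNReal.ofReal_ne_top hbase, mul_comm,
      ← ENNReal.ofReal_natCast, ← ENNReal.ofReal_mul (by positivity),
      ← ENNReal.ofReal_add (by positivity) (by linarith)]
    exact ofReal_le_approxExponent_linError hn θ hw0.le
      (exists_simError_le_of_infinite hn hindep hw0 hw)
  · refine ENNReal.div_le_of_le_mul (iSup₂_le fun w hw => ?_)
    rcases le_or_gt w 0 with hw0 | hw0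
    · simp [ENNReal.ofReal_of_nonpos hw0]
    have h := ofReal_le_approxExponent_simError hn θ hw0
      (exists_linError_le_of_infinite hn hindep hw0 hw)
    have hn0 : (0 : ℝ) ≤ n - 1 := by linarith
    have hd : 0 < (n - 1) * w + n := by positivity
    have hwle : ENNReal.ofReal w ≤ approxExponent (linError θ) :=
      le_iSup₂ (f := fun (w : ℝ) (_ : w ∈ {w : ℝ | (approxSet (linError θ) w).Infinite}) =>
        ENNReal.ofReal w) w hw
    calc ENNReal.ofReal w
        = ENNReal.ofReal (w / ((n - 1) * w + n)) * ENNReal.ofReal ((n - 1) * w + n) := by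
          rw [← ENNReal.ofReal_mul (by positivity), div_mul_cancel₀ _ hd.ne']
      _ = ENNReal.ofReal (w / ((n - 1) * w + n)) *
            (ENNReal.ofReal (n - 1) * ENNReal.ofReal w + n) := by
          rw [ENNReal.ofReal_add (by positivity) (by positivity), ENNReal.ofReal_mul hn0,
            ENNReal.ofReal_natCast]
      _ ≤ _ := by gcongr
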